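/- arXiv:2010.00621 — 7 statements merged into one kernel-verified Lean document; each statement's English description precedes it below -/
import Mathlib

section
/- Let E be a real inner product space and let g > 0 and β > 0 be real constants. Define T(A) := (1 / max(g, β‖A‖)) • A for A ∈ E. Then T is a monotone map: for all A, B ∈ E, ⟨T(A) − T(B), A − B⟩ ≥ 0. -/
open scoped RealInnerProductSpace

theorem inner_smul_sub_smul_sub_nonneg
    {E : Type*} [NormedAddCommGroup E] [InnerProductSpace ℝ E] {a b : ℝ}
    (ha : 0 ≤ a) (hb : 0 ≤ b) (A B : E)
    (h : 0 ≤ (a * ‖A‖ - b * ‖B‖) * (‖A‖ - ‖B‖)) :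
    0 ≤ ⟪a • A - b • B, A - B⟫ := by
  have hAB := mul_le_mul_of_nonneg_left (real_inner_le_norm A B) (add_nonneg ha hb)
  simp only [inner_sub_left, inner_sub_right, real_inner_smul_left,
    real_inner_self_eq_norm_sq, real_inner_comm A B]
  linarith

theorem monotoneOn_one_div_max_mul {g β : ℝ} (hg : 0 < g) :
    MonotoneOn (fun t : ℝ => 1 / max g (β * t) * t) (Set.Ici 0) := by
  intro x hx y hy hxy
  simp only [one_div_mul_eq_div]
  rw [div_le_div_iff₀ (lt_max_of_lt_left hg) (lt_max_of_lt_left hg),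
    mul_max_of_nonneg _ _ hx, mul_max_of_nonneg _ _ hy]
  exact max_le_max (mul_le_mul_of_nonneg_right hxy hg.le) (by linarith)

/-- Monotonicity of the regularized normalization map T(A) = A / max(g, β‖A‖). -/
theorem huberNormalization_monotone
    {E : Type*} [NormedAddCommGroup E] [InnerProductSpace ℝ E]
    (g β : ℝ) (hg : 0 < g) (hβ : 0 < β)
    (T : E → E) (hT : ∀ A : E, T A = (1 / max g (β * ‖A‖)) • A) :
    ∀ A B : E, ⟪T A - T B, A - B⟫ ≥ 0 := by
  intro A B
  have hpos (C : E) : 0 ≤ 1 / max g (β * ‖C‖) :=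
    one_div_nonneg.mpr (lt_max_of_lt_left hg).le
  rw [hT, hT]
  refine inner_smul_sub_smul_sub_nonneg (hpos A) (hpos B) A B ?_
  have hmono := monotoneOn_one_div_max_mul (β := β) hg
  rcases le_total ‖A‖ ‖B‖ with h | h
  · exact mul_nonneg_of_nonpos_of_nonpos
      (sub_nonpos.mpr (hmono (norm_nonneg A) (norm_nonneg B) h)) (sub_nonpos.mpr h)
  · exact mul_nonneg
      (sub_nonneg.mpr (hmono (norm_nonneg B) (norm_nonneg A) h)) (sub_nonneg.mpr h)
end

section
/- Let E be a real normed space and let σ > 0 and γ > 0 be real constants. The map φ : E → E defined by φ(y) := (σγ / max(σ, γ‖y‖)) • y is Lipschitz continuous with Lipschitz constant 2γ. -/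
/-- The map φ(y) = (σγ / max(σ, γ‖y‖)) • y is Lipschitz with constant 2γ (Lemma 8.1). -/
theorem huberNormalization_lipschitz
    {E : Type*} [NormedAddCommGroup E] [NormedSpace ℝ E]
    (σ γ : ℝ) (hσ : 0 < σ) (hγ : 0 < γ)
    (φ : E → E) (hφ : ∀ y : E, φ y = (σ * γ / max σ (γ * ‖y‖)) • y) :
    LipschitzWith (Real.toNNReal (2 * γ)) φ := by
  refine LipschitzWith.of_dist_le_mul fun x y => ?_
  rw [Real.coe_toNNReal _ (by positivity), dist_eq_norm, dist_eq_norm, hφ, hφ]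
  set a := max σ (γ * ‖x‖) with ha
  set b := max σ (γ * ‖y‖) with hb
  have hσa : σ ≤ a := le_max_left _ _
  have hyb : γ * ‖y‖ ≤ b := le_max_right _ _
  have ha0 : 0 < a := hσ.trans_le hσa
  have hb0 : 0 < b := hσ.trans_le (le_max_left _ _)
  have hba : |b - a| ≤ γ * ‖x - y‖ := by
    calc |b - a| ≤ |γ * ‖y‖ - γ * ‖x‖| := by
          simpa [ha, hb] using abs_max_sub_max_le_max σ (γ * ‖y‖) σ (γ * ‖x‖)
      _ = γ * |‖y‖ - ‖x‖| := by rw [← mul_sub, abs_mul, abs_of_pos hγ]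
      _ ≤ γ * ‖x - y‖ := by
          rw [norm_sub_rev x y]
          gcongr
          exact abs_norm_sub_norm_le y x
  have hsplit : (σ * γ / a) • x - (σ * γ / b) • y =
      (σ / a * γ) • (x - y) + (σ / a * ((b - a) * (γ / b))) • y := by
    have hcoeff : σ / a * ((b - a) * (γ / b)) = σ * γ / a - σ * γ / b := by
      field_simp
    rw [hcoeff]
    module
  have hσa1 : σ / a ≤ 1 := (div_le_one ha0).2 hσa
  have hyb1 : γ / b * ‖y‖ ≤ 1 := by
    rw [div_mul_eq_mul_div]
    exact (div_le_one hb0).2 hyb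
  rw [hsplit]
  calc _ ≤ ‖(σ / a * γ) • (x - y)‖ + ‖(σ / a * ((b - a) * (γ / b))) • y‖ := norm_add_le _ _
    _ = σ / a * (γ * ‖x - y‖) + σ / a * (|b - a| * (γ / b * ‖y‖)) := by
        simp only [norm_smul, Real.norm_eq_abs, abs_mul, abs_div, abs_of_pos hσ, abs_of_pos hγ,
          abs_of_pos ha0, abs_of_pos hb0]
        ring
    _ ≤ 1 * (γ * ‖x - y‖) + 1 * (γ * ‖x - y‖ * 1) := by gcongr
    _ = 2 * γ * ‖x - y‖ := by ring
end

section
/- Let (Ω, μ) be a measure space, E a real normed space (with the Borel σ-algebra), and let g > 0 and β > 0 be real constants. Define Θ(y) := (gβ / max(g, β‖y‖)) • y for y ∈ E. Then for all strongly measurable functions f₁, f₂ : Ω → E, the L²-seminorms satisfy eLpNorm (x ↦ Θ(f₁(x)) − Θ(f₂(x))) 2 μ ≤ 2β · eLpNorm (x ↦ f₁(x) − f₂(x)) 2 μ; that is, the superposition operator u ↦ Θ∘u is Lipschitz continuous in L² with constant 2β. -/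
open MeasureTheory

/-- The regularized normalization map `y ↦ (g * β / max g (β * ‖y‖)) • y` is Lipschitz with
constant `2 * β`. -/
theorem norm_regularized_normalization_sub_le {E : Type*} [SeminormedAddCommGroup E]
    [NormedSpace ℝ E] {g β : ℝ} (hg : 0 < g) (hβ : 0 < β) (y z : E) :
    ‖(g * β / max g (β * ‖y‖)) • y - (g * β / max g (β * ‖z‖)) • z‖ ≤ 2 * β * ‖y - z‖ := by
  set A := max g (β * ‖y‖) with hA
  set B := max g (β * ‖z‖) with hB
  have hgA : g ≤ A := le_max_left _ _
  have hzB : β * ‖z‖ ≤ B := le_max_right _ _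
  have hA0 : 0 < A := hg.trans_le hgA
  have hB0 : 0 < B := hg.trans_le (le_max_left _ _)
  have hBA : |B - A| ≤ β * ‖y - z‖ := by
    calc |B - A| ≤ |β * ‖z‖ - β * ‖y‖| := by
          rw [hA, hB, max_comm g, max_comm g]
          exact abs_max_sub_max_le_abs _ _ _
      _ = β * |‖z‖ - ‖y‖| := by rw [← mul_sub, abs_mul, abs_of_pos hβ]
      _ ≤ β * ‖y - z‖ := by
          rw [norm_sub_rev y z]
          gcongr
          exact abs_norm_sub_norm_le z y
  have hcA : g * β / A ≤ β := by
    rw [div_le_iff₀ hA0, mul_comm g]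
    gcongr
  have hsplit : (g * β / A) • y - (g * β / B) • z =
      (g * β / A) • (y - z) + (g * β / A * ((B - A) / B)) • z := by
    have : g * β / A * ((B - A) / B) = g * β / A - g * β / B := by field_simp
    rw [this, smul_sub, sub_smul]
    abel
  have hfst : ‖(g * β / A) • (y - z)‖ ≤ β * ‖y - z‖ := by
    rw [norm_smul, Real.norm_of_nonneg (by positivity)]
    gcongr
  have hsnd : ‖(g * β / A * ((B - A) / B)) • z‖ ≤ β * ‖y - z‖ := by
    rw [norm_smul, Real.norm_eq_abs, abs_mul, abs_div (B - A), abs_of_pos hB0,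
      abs_of_pos (by positivity : 0 < g * β / A)]
    calc g * β / A * (|B - A| / B) * ‖z‖
        = g / A * |B - A| * (β * ‖z‖ / B) := by ring
      _ ≤ 1 * (β * ‖y - z‖) * 1 := by
          gcongr
          · exact (div_le_one hA0).2 hgA
          · exact (div_le_one hB0).2 hzB
      _ = β * ‖y - z‖ := by ring
  rw [hsplit]
  linarith [norm_add_le ((g * β / A) • (y - z)) ((g * β / A * ((B - A) / B)) • z)]

/-- L²-Lipschitz estimate for the superposition operator associated to
Θ(y) = (gβ / max(g, β‖y‖)) • y (Corollary 5.4). -/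
theorem superposition_lipschitz_L2
    {Ω : Type*} [MeasurableSpace Ω] (μ : Measure Ω)
    {E : Type*} [NormedAddCommGroup E] [NormedSpace ℝ E]
    [MeasurableSpace E] [BorelSpace E]
    (g β : ℝ) (hg : 0 < g) (hβ : 0 < β)
    (Θ : E → E) (hΘ : ∀ y : E, Θ y = (g * β / max g (β * ‖y‖)) • y)
    (f₁ f₂ : Ω → E) (hf₁ : StronglyMeasurable f₁) (hf₂ : StronglyMeasurable f₂) :
    eLpNorm (fun x => Θ (f₁ x) - Θ (f₂ x)) 2 μ ≤
      ENNReal.ofReal (2 * β) * eLpNorm (fun x => f₁ x - f₂ x) 2 μ := by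
  refine eLpNorm_le_mul_eLpNorm_of_ae_le_mul (Filter.Eventually.of_forall fun x => ?_) 2
  rw [hΘ, hΘ]
  exact norm_regularized_normalization_sub_le hg hβ _ _
end

section
/- Let H be a real Hilbert space, F a real normed space, D : H → F a continuous linear map, and J : H → ℝ a convex function that is Fréchet differentiable at a point ũ ∈ H with D ũ = 0. Suppose there exists a continuous linear functional λ ∈ F* such that the first-order optimality (KKT) condition ⟨J'(ũ), v⟩ + λ(D v) = 0 holds for all v ∈ H. Then for every σ ≥ ‖λ‖_{F*} and every u ∈ H one has J(ũ) + σ‖D ũ‖ ≤ J(u) + σ‖D u‖; i.e., ũ is a global minimizer of the penalized functional J_σ(u) := J(u) + σ‖D u‖. -/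
/-- A convex function lies above its tangent at any point of Fréchet differentiability. -/
theorem ConvexOn.add_hasFDerivAt_sub_le
    {E : Type*} [NormedAddCommGroup E] [NormedSpace ℝ E] {s : Set E} {f : E → ℝ}
    {f' : E →L[ℝ] ℝ} {x y : E} (hf : ConvexOn ℝ s f) (hx : x ∈ s) (hy : y ∈ s)
    (hf' : HasFDerivAt f f' x) : f x + f' (y - x) ≤ f y := by
  have hconv := hf.comp_affineMap (AffineMap.lineMap (k := ℝ) x y)
  have hderiv : HasDerivAt (f ∘ AffineMap.lineMap (k := ℝ) x y) (f' (y - x)) 0 :=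
    HasFDerivAt.comp_hasDerivAt (0 : ℝ) (by simpa using hf') AffineMap.hasDerivAt_lineMap
  have h := hconv.le_slope_of_hasDerivAt (x := 0) (y := 1) (by simpa using hx)
    (by simpa using hy) one_pos hderiv
  simp only [slope_def_field, Function.comp_apply, AffineMap.lineMap_apply_one,
    AffineMap.lineMap_apply_zero, sub_zero, div_one] at h
  linarith

/-- Exact penalization, part 1 (Theorem 3.1): a KKT point ũ with D ũ = 0 is a
global minimizer of the penalized functional J_σ(u) = J(u) + σ‖D u‖ for σ ≥ ‖λ‖. -/
theorem exact_penalization_minimizer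
    {H : Type*} [NormedAddCommGroup H] [InnerProductSpace ℝ H] [CompleteSpace H]
    {F : Type*} [NormedAddCommGroup F] [NormedSpace ℝ F]
    (D : H →L[ℝ] F)
    (J : H → ℝ) (hJconv : ConvexOn ℝ Set.univ J)
    (u₀ : H) (J' : H →L[ℝ] ℝ) (hJ' : HasFDerivAt J J' u₀)
    (hdiv : D u₀ = 0)
    (lam : F →L[ℝ] ℝ) (hKKT : ∀ v : H, J' v + lam (D v) = 0) :
    ∀ σ : ℝ, σ ≥ ‖lam‖ → ∀ u : H,
      J u₀ + σ * ‖D u₀‖ ≤ J u + σ * ‖D u‖ := by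
  intro σ hσ u
  have htangent := hJconv.add_hasFDerivAt_sub_le (Set.mem_univ u₀) (Set.mem_univ u) hJ'
  have hK := hKKT (u - u₀)
  rw [map_sub D, hdiv, sub_zero] at hK
  have hlam : lam (D u) ≤ σ * ‖D u‖ :=
    (le_abs_self _).trans (lam.le_of_opNorm_le hσ (D u))
  rw [hdiv, norm_zero, mul_zero]
  linarith
end

section
/- Let H and F be real Hilbert spaces, D : H → F a continuous linear map, and J : H → ℝ a Fréchet differentiable function whose gradient ∇J is strongly monotone with constant C > 0, i.e., ⟨∇J(u) − ∇J(v), u − v⟩ ≥ C‖u − v‖² for all u, v ∈ H. Let ũ ∈ H satisfy D ũ = 0 and suppose there exists p ∈ F such that ⟨∇J(ũ), v⟩ = −⟨p, D v⟩_F for all v ∈ H. Let ν > 0 and let u_ν ∈ H satisfy the penalized optimality condition ⟨∇J(u_ν), v⟩ + ν ⟨D u_ν, D v⟩_F = 0 for all v ∈ H. Then C‖u_ν − ũ‖² ≤ ‖p‖²/(2ν) and ν‖D u_ν‖ ≤ ‖p‖. In particular, u_ν → ũ strongly in H as ν → ∞. -/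
open scoped RealInnerProductSpace
open Filter

/-- Energy estimate for a penalized stationary point, tested against its distance to a constrained
stationary point with multiplier `p`. -/
theorem penalized_energy_le
    {H : Type*} [NormedAddCommGroup H] [InnerProductSpace ℝ H]
    {F : Type*} [NormedAddCommGroup F] [InnerProductSpace ℝ F]
    {D : H →L[ℝ] F} {A : H → H} {C ν : ℝ} {u u₀ : H} {p : F}
    (hmono : C * ‖u - u₀‖ ^ 2 ≤ ⟪A u - A u₀, u - u₀⟫)
    (hdiv : D u₀ = 0) (hp : ∀ v : H, ⟪A u₀, v⟫ = -⟪p, D v⟫)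
    (heuler : ∀ v : H, ⟪A u, v⟫ + ν * ⟪D u, D v⟫ = 0) :
    C * ‖u - u₀‖ ^ 2 + ν * ‖D u‖ ^ 2 ≤ ‖p‖ * ‖D u‖ := by
  have h₁ := heuler (u - u₀)
  have h₂ := hp (u - u₀)
  rw [map_sub, hdiv, sub_zero] at h₁ h₂
  rw [real_inner_self_eq_norm_sq] at h₁
  rw [inner_sub_left] at hmono
  linarith [real_inner_le_norm p (D u)]

/-- Convergence of the quadratic penalization (Theorem 3.3). -/
theorem quadratic_penalization_convergence
    {H : Type*} [NormedAddCommGroup H] [InnerProductSpace ℝ H] [CompleteSpace H]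
    {F : Type*} [NormedAddCommGroup F] [InnerProductSpace ℝ F] [CompleteSpace F]
    (D : H →L[ℝ] F)
    (J : H → ℝ) (gradJ : H → H) (hJ : ∀ u : H, HasGradientAt J (gradJ u) u)
    (C : ℝ) (hC : 0 < C)
    (hmono : ∀ u v : H, ⟪gradJ u - gradJ v, u - v⟫ ≥ C * ‖u - v‖ ^ 2)
    (u₀ : H) (hdiv : D u₀ = 0)
    (p : F) (hp : ∀ v : H, ⟪gradJ u₀, v⟫ = -⟪p, D v⟫)
    (u : ℝ → H)
    (heuler : ∀ ν : ℝ, 0 < ν →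
      ∀ v : H, ⟪gradJ (u ν), v⟫ + ν * ⟪D (u ν), D v⟫ = 0) :
    (∀ ν : ℝ, 0 < ν →
      C * ‖u ν - u₀‖ ^ 2 ≤ ‖p‖ ^ 2 / (2 * ν) ∧ ν * ‖D (u ν)‖ ≤ ‖p‖) ∧
    Tendsto u atTop (nhds u₀) := by
  have bounds : ∀ ν : ℝ, 0 < ν →
      C * ‖u ν - u₀‖ ^ 2 ≤ ‖p‖ ^ 2 / (2 * ν) ∧ ν * ‖D (u ν)‖ ≤ ‖p‖ := by
    intro ν hν
    have energy := penalized_energy_le (hmono (u ν) u₀) hdiv hp (heuler ν hν)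
    constructor
    · rw [le_div_iff₀ (by positivity)]
      nlinarith [mul_le_mul_of_nonneg_left energy hν.le, sq_nonneg (‖p‖ - ν * ‖D (u ν)‖),
        sq_nonneg (ν * ‖D (u ν)‖)]
    · rcases (norm_nonneg (D (u ν))).eq_or_lt with h | h
      · simp [← h]
      · refine le_of_mul_le_mul_right ?_ h
        nlinarith [mul_nonneg hC.le (sq_nonneg ‖u ν - u₀‖)]
  refine ⟨bounds, ?_⟩
  rw [tendsto_iff_norm_sub_tendsto_zero]
  have hlim : Tendsto (fun ν : ℝ => √(‖p‖ ^ 2 / (2 * ν) / C)) atTop (nhds 0) := by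
    have h : Tendsto (fun ν : ℝ => ‖p‖ ^ 2 / (2 * ν) / C) atTop (nhds 0) := by
      simpa using (tendsto_const_nhds.div_atTop
        (tendsto_id.const_mul_atTop (two_pos : (0 : ℝ) < 2))).div_const C
    simpa using h.sqrt
  refine squeeze_zero' (Eventually.of_forall fun ν => norm_nonneg _) ?_ hlim
  filter_upwards [eventually_gt_atTop 0] with ν hν
  refine Real.le_sqrt_of_sq_le ?_
  rw [le_div_iff₀ hC, mul_comm]
  exact (bounds ν hν).1
end

section
/- Let H and F be real Hilbert spaces, D : H → F a continuous linear map, and let γ > 0 and C > 0 be real constants. Let a, b : H × H → ℝ be bilinear forms with a(v, v) ≥ C‖v‖² for all v ∈ H and b(v, v) ≥ γ‖D v‖²_F for all v ∈ H. Let d ∈ H and suppose w ∈ H satisfies a(w, v) + b(w, v) = −⟨d, v⟩ for all v ∈ H. Then ‖D w‖²_F ≤ ‖d‖² / (γ C). -/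
open scoped RealInnerProductSpace

/-- Divergence control of the descent direction (Theorem 6.1). -/
theorem divergence_of_descent_direction
    {H : Type*} [NormedAddCommGroup H] [InnerProductSpace ℝ H] [CompleteSpace H]
    {F : Type*} [NormedAddCommGroup F] [InnerProductSpace ℝ F] [CompleteSpace F]
    (D : H →L[ℝ] F)
    (γ C : ℝ) (hγ : 0 < γ) (hC : 0 < C)
    (a b : H →ₗ[ℝ] H →ₗ[ℝ] ℝ)
    (ha : ∀ v : H, a v v ≥ C * ‖v‖ ^ 2)
    (hb : ∀ v : H, b v v ≥ γ * ‖D v‖ ^ 2)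
    (d : H) (w : H)
    (hw : ∀ v : H, a w v + b w v = -⟪d, v⟫) :
    ‖D w‖ ^ 2 ≤ ‖d‖ ^ 2 / (γ * C) := by
  have hdw : -⟪d, w⟫ ≤ ‖d‖ * ‖w‖ :=
    (neg_le_abs _).trans (abs_real_inner_le_norm d w)
  have energy : C * ‖w‖ ^ 2 + γ * ‖D w‖ ^ 2 ≤ ‖d‖ * ‖w‖ := by
    linarith [ha w, hb w, hw w]
  rw [le_div_iff₀ (mul_pos hγ hC)]
  nlinarith [mul_le_mul_of_nonneg_left energy hC.le, sq_nonneg (‖d‖ - 2 * (C * ‖w‖)),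
    sq_nonneg ‖d‖]
end

section
/- Let H be a real Hilbert space, let L > 0, C > 0 and C̃ > 0 be real constants, and let J : H → ℝ be Fréchet differentiable with gradient ∇J Lipschitz continuous with constant L. Let a : H × H → ℝ be a bilinear form satisfying C‖v‖² ≤ a(v, v) for all v ∈ H and |a(v, z)| ≤ C̃‖v‖ ‖z‖ for all v, z ∈ H. Fix u ∈ H and suppose w ∈ H satisfies a(w, v) = −⟨∇J(u), v⟩ for all v ∈ H. Then for every α > 0, J(u + α w) − J(u) ≤ −α (C/C̃² − α L/(2C²)) ‖∇J(u)‖². In particular, for 0 < α < 2C³/(L C̃²) the right-hand side is strictly negative whenever ∇J(u) ≠ 0, so the step produces a sufficient decrease. -/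
open scoped RealInnerProductSpace

/-- Descent lemma: a function with `L`-Lipschitz gradient lies below its first-order expansion
plus `L / 2` times the squared distance. -/
theorem sub_le_inner_add_of_lipschitz_gradient
    {E : Type*} [NormedAddCommGroup E] [InnerProductSpace ℝ E] {L : ℝ} {f : E → ℝ} {g : E → E}
    (hf : ∀ x, HasFDerivAt f (innerSL ℝ (g x)) x)
    (hg : ∀ x y, ‖g x - g y‖ ≤ L * ‖x - y‖) (x d : E) :
    f (x + d) - f x ≤ ⟪g x, d⟫ + L / 2 * ‖d‖ ^ 2 := by
  have hline (t : ℝ) : HasDerivAt (fun t : ℝ => f (x + t • d)) ⟪g (x + t • d), d⟫ t := by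
    have hd : HasDerivAt (fun t : ℝ => x + t • d) d t := by
      simpa using ((hasDerivAt_id t).smul_const d).const_add x
    exact (hf (x + t • d)).comp_hasDerivAt t hd
  have hquad (t : ℝ) : HasDerivAt (fun t : ℝ => f x + t * ⟪g x, d⟫ + L / 2 * ‖d‖ ^ 2 * t ^ 2)
      (⟪g x, d⟫ + L * ‖d‖ ^ 2 * t) t := by
    have h := (((hasDerivAt_id t).mul_const ⟪g x, d⟫).const_add (f x)).add
      ((hasDerivAt_pow 2 t).const_mul (L / 2 * ‖d‖ ^ 2))
    refine h.congr_deriv ?_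
    push_cast
    ring
  have hslope (t : ℝ) (ht : 0 ≤ t) : ⟪g (x + t • d), d⟫ ≤ ⟪g x, d⟫ + L * ‖d‖ ^ 2 * t := by
    have hinner : ⟪g (x + t • d) - g x, d⟫ ≤ L * ‖d‖ ^ 2 * t :=
      calc ⟪g (x + t • d) - g x, d⟫ ≤ ‖g (x + t • d) - g x‖ * ‖d‖ := real_inner_le_norm _ _
        _ ≤ L * ‖(x + t • d) - x‖ * ‖d‖ := by gcongr; exact hg _ _
        _ = L * ‖d‖ ^ 2 * t := by
          rw [add_sub_cancel_left, norm_smul, Real.norm_of_nonneg ht]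
          ring
    rw [inner_sub_left] at hinner
    linarith
  have h := image_le_of_deriv_right_le_deriv_boundary (a := 0) (b := 1)
    (fun t _ => (hline t).continuousAt.continuousWithinAt)
    (fun t _ => (hline t).hasDerivWithinAt) (by simp)
    (fun t _ => (hquad t).continuousAt.continuousWithinAt)
    (fun t _ => (hquad t).hasDerivWithinAt) (fun t ht => hslope t ht.1)
    (Set.right_mem_Icc.2 zero_le_one)
  simp only [one_smul, one_mul, one_pow, mul_one] at h
  linarith

/-- Sufficient decrease condition (Lemma 7.3). -/
theorem sufficient_decrease
    {H : Type*} [NormedAddCommGroup H] [InnerProductSpace ℝ H] [CompleteSpace H]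
    (L C Ct : ℝ) (hL : 0 < L) (hC : 0 < C) (hCt : 0 < Ct)
    (J : H → ℝ) (gradJ : H → H)
    (hJ : ∀ u : H, HasFDerivAt J (innerSL ℝ (gradJ u)) u)
    (hlip : ∀ u v : H, ‖gradJ u - gradJ v‖ ≤ L * ‖u - v‖)
    (a : H →ₗ[ℝ] H →ₗ[ℝ] ℝ)
    (hcoer : ∀ v : H, C * ‖v‖ ^ 2 ≤ a v v)
    (hbdd : ∀ v z : H, |a v z| ≤ Ct * ‖v‖ * ‖z‖)
    (u w : H) (hw : ∀ v : H, a w v = -⟪gradJ u, v⟫) :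
    (∀ α : ℝ, 0 < α →
      J (u + α • w) - J u ≤
        -α * (C / Ct ^ 2 - α * L / (2 * C ^ 2)) * ‖gradJ u‖ ^ 2) ∧
    (∀ α : ℝ, 0 < α → α < 2 * C ^ 3 / (L * Ct ^ 2) → gradJ u ≠ 0 →
      J (u + α • w) - J u < 0) := by
  have hgrad_le : ‖gradJ u‖ ≤ Ct * ‖w‖ := by
    have h := hbdd w (gradJ u)
    rw [hw, real_inner_self_eq_norm_sq, abs_neg, abs_of_nonneg (sq_nonneg _)] at h
    rcases (norm_nonneg (gradJ u)).eq_or_lt with h0 | hpos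
    · rw [← h0]
      positivity
    · exact le_of_mul_le_mul_right (by rwa [← sq]) hpos
  have hdescent : C * ‖w‖ ^ 2 ≤ -⟪gradJ u, w⟫ := hw w ▸ hcoer w
  have hw_le : C * ‖w‖ ≤ ‖gradJ u‖ := by
    have h := (neg_le_abs _).trans (abs_real_inner_le_norm (gradJ u) w)
    rcases (norm_nonneg w).eq_or_lt with h0 | hpos
    · rw [← h0, mul_zero]
      positivity
    · exact le_of_mul_le_mul_right (by linarith) hpos
  have hlower : ‖gradJ u‖ ^ 2 / Ct ^ 2 ≤ ‖w‖ ^ 2 := by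
    rw [div_le_iff₀ (by positivity), ← mul_pow, mul_comm]
    gcongr
  have hupper : ‖w‖ ^ 2 ≤ ‖gradJ u‖ ^ 2 / C ^ 2 := by
    rw [le_div_iff₀ (by positivity), ← mul_pow, mul_comm]
    gcongr
  have hdecrease (α : ℝ) (hα : 0 < α) : J (u + α • w) - J u ≤
      -α * (C / Ct ^ 2 - α * L / (2 * C ^ 2)) * ‖gradJ u‖ ^ 2 :=
    calc J (u + α • w) - J u ≤ ⟪gradJ u, α • w⟫ + L / 2 * ‖α • w‖ ^ 2 :=
          sub_le_inner_add_of_lipschitz_gradient hJ hlip u (α • w)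
      _ = α * ⟪gradJ u, w⟫ + L / 2 * α ^ 2 * ‖w‖ ^ 2 := by
          rw [real_inner_smul_right, norm_smul, Real.norm_of_nonneg hα.le]
          ring
      _ ≤ α * -(C * (‖gradJ u‖ ^ 2 / Ct ^ 2)) + L / 2 * α ^ 2 * (‖gradJ u‖ ^ 2 / C ^ 2) := by
          have h := mul_le_mul_of_nonneg_left hlower hC.le
          gcongr
          linarith
      _ = -α * (C / Ct ^ 2 - α * L / (2 * C ^ 2)) * ‖gradJ u‖ ^ 2 := by
          field_simp
          ring
  refine ⟨hdecrease, fun α hα hα_lt hgrad => (hdecrease α hα).trans_lt ?_⟩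
  have hcoef : 0 < C / Ct ^ 2 - α * L / (2 * C ^ 2) := by
    rw [lt_div_iff₀ (by positivity)] at hα_lt
    rw [sub_pos, div_lt_div_iff₀ (by positivity) (by positivity)]
    linarith
  have hpos : 0 < α * (C / Ct ^ 2 - α * L / (2 * C ^ 2)) * ‖gradJ u‖ ^ 2 := by positivity
  linarith
end
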